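/- arXiv:1902.07628 — 2 statements merged into one kernel-verified Lean document; each statement's English description precedes it below -/
import Mathlib

section
/- For the supplementary code B = B_{u,m} of length n_B = (q^m - q^u)/(q-1), the number of vectors in F_q^{n_B} at distance exactly 1 from B is q^{n_B - m}(q^m - q^u), and the number at distance exactly 2 from B is q^{n_B - m}(q^u - 1). -/
/-- The distance from a vector `x` to a code `C`. -/
noncomputable def distToCode {F : Type} [Fintype F] [DecidableEq F] {n : ℕ}
    (C : Set (Fin n → F)) (x : Fin n → F) : ℕ :=
  sInf (Set.image (hammingDist x) C)

/-- The supplementary code `B_{u,m}`: the code whose parity-check matrix consists of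
the `inr`-columns of `H`. -/
def suppCode {F : Type} [Field F] {m nu nB : ℕ}
    (H : Matrix (Fin m) (Fin nu ⊕ Fin nB) F) : Submodule F (Fin nB → F) :=
  LinearMap.ker (Matrix.mulVecLin (Matrix.of fun i j => H i (Sum.inr j)))

/-- The vectors of `F^m` supported on the first `u` coordinates. -/
def initialVectors (F : Type) [Field F] [Fintype F] [DecidableEq F] (m u : ℕ) :
    Finset (Fin m → F) :=
  Fintype.piFinset fun i => if (i : ℕ) < u then Finset.univ else {0}

section

variable {F : Type} [Field F]

lemma mem_initialVectors [Fintype F] [DecidableEq F] {m u : ℕ} {v : Fin m → F} :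
    v ∈ initialVectors F m u ↔ ∀ i : Fin m, u ≤ (i : ℕ) → v i = 0 := by
  simp only [initialVectors, Fintype.mem_piFinset]
  refine forall_congr' fun i => ?_
  by_cases h : (i : ℕ) < u
  · simp [h, Nat.not_le.mpr h]
  · simp [h, Nat.not_lt.mp h]

lemma card_initialVectors [Fintype F] [DecidableEq F] {m u : ℕ} (hum : u ≤ m) :
    (initialVectors F m u).card = Fintype.card F ^ u := by
  have h : ∀ i : Fin m, (if (i : ℕ) < u then (Finset.univ : Finset F) else {0}).card
      = if (i : ℕ) < u then Fintype.card F else 1 := by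
    intro i
    split_ifs <;> simp
  rw [initialVectors, Fintype.card_piFinset, Finset.prod_congr rfl fun i _ => h i,
    Finset.prod_ite]
  simp [Fin.card_filter_val_lt, hum]

/-- The preimage of a finset under a surjective linear map `F^n → F^m`. -/
lemma card_preimage_of_surjective [Fintype F] {m n : ℕ} (S : (Fin n → F) →ₗ[F] (Fin m → F))
    (hS : Function.Surjective S) (T : Finset (Fin m → F)) :
    Nat.card {x : Fin n → F | S x ∈ T} = Fintype.card F ^ (n - m) * T.card := by
  obtain ⟨g, hg⟩ := S.exists_rightInverse_of_surjective (LinearMap.range_eq_top.mpr hS)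
  have hg' : ∀ y, S (g y) = y := fun y => LinearMap.congr_fun hg y
  let e : {x : Fin n → F | S x ∈ T} ≃ LinearMap.ker S × T :=
    { toFun := fun x => (⟨x.1 - g (S x.1), by simp [hg']⟩, ⟨S x.1, x.2⟩)
      invFun := fun p => ⟨p.1.1 + g p.2.1, by
        have := LinearMap.mem_ker.mp p.1.2
        simp [hg', this]⟩
      left_inv := fun x => by simp
      right_inv := fun p => by
        have := LinearMap.mem_ker.mp p.1.2
        ext <;> simp [hg', this] }
  have hr := S.finrank_range_add_finrank_ker
  rw [LinearMap.range_eq_top.mpr hS, finrank_top, Module.finrank_fin_fun,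
    Module.finrank_fin_fun] at hr
  have hk : Module.finrank F (LinearMap.ker S) = n - m := by omega
  rw [Nat.card_congr e, Nat.card_prod, Module.natCard_eq_pow_finrank (K := F), hk]
  simp

lemma hammingDist_eq_hammingNorm_sub [DecidableEq F] {n : ℕ} (x y : Fin n → F) :
    hammingDist x y = hammingNorm (x - y) := by
  simp [hammingDist, hammingNorm, sub_ne_zero]

/-- Distances to the kernel of `S` are minimal weights of vectors with a given syndrome. -/
lemma distToCode_ker_eq [Fintype F] [DecidableEq F]
    {m n : ℕ} (S : (Fin n → F) →ₗ[F] (Fin m → F)) (x : Fin n → F) (d : ℕ)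
    (hle : ∃ e, S e = S x ∧ hammingNorm e ≤ d)
    (hge : ∀ e, S e = S x → d ≤ hammingNorm e) :
    distToCode ((LinearMap.ker S : Submodule F (Fin n → F)) : Set (Fin n → F)) x = d := by
  obtain ⟨e, he, hed⟩ := hle
  apply le_antisymm
  · refine (Nat.sInf_le (Set.mem_image_of_mem (hammingDist x) (show x - e ∈ _ from ?_))).trans ?_
    · simp [he]
    · rw [hammingDist_eq_hammingNorm_sub]
      simpa using hed
  · refine le_csInf ⟨_, Set.mem_image_of_mem _ (Submodule.zero_mem _)⟩ ?_
    rintro _ ⟨c, hc, rfl⟩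
    rw [hammingDist_eq_hammingNorm_sub]
    have hc' : S c = 0 := hc
    exact hge _ (by simp [hc'])

lemma hammingNorm_single_le_one [DecidableEq F] {n : ℕ} (j : Fin n) (a : F) :
    hammingNorm (Pi.single j a : Fin n → F) ≤ 1 := by
  rw [hammingNorm, Finset.card_le_one]
  have h : ∀ i, (Pi.single j a : Fin n → F) i ≠ 0 → i = j := by
    intro i hi
    by_contra hij
    exact hi (Pi.single_eq_of_ne hij _)
  intro i hi k hk
  rw [h i (by simpa using hi), h k (by simpa using hk)]

lemma exists_eq_single_of_hammingNorm_le_one [DecidableEq F] {n : ℕ} {e : Fin n → F}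
    (he : hammingNorm e ≤ 1) (h0 : e ≠ 0) : ∃ j, ∃ a : F, e = Pi.single j a := by
  obtain ⟨j, hj⟩ := Function.ne_iff.mp h0
  refine ⟨j, e j, funext fun i => ?_⟩
  rw [hammingNorm, Finset.card_le_one] at he
  by_cases hij : i = j
  · subst hij
    simp
  · rw [Pi.single_eq_of_ne hij]
    by_contra hi
    exact hij (he i (by simpa using hi) j (by simpa using hj))

lemma hammingNorm_sub_le_add [DecidableEq F] {n : ℕ} (x y : Fin n → F) :
    hammingNorm (x - y) ≤ hammingNorm x + hammingNorm y := by
  rw [← hammingDist_eq_hammingNorm_sub, ← hammingDist_zero_right x, ← hammingDist_zero_left]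
  exact hammingDist_triangle x 0 y

/-- If pairwise nonproportional nonzero columns in `initialVectors F m u` are as many as the
points of the corresponding projective space, they represent all of its points. -/
lemma exists_eq_smul_of_mem_initialVectors [Fintype F] [DecidableEq F]
    {m u ν : ℕ} (hum : u ≤ m)
    (hν : ν * (Fintype.card F - 1) = Fintype.card F ^ u - 1) (c : Fin ν → Fin m → F)
    (hc : ∀ j, c j ≠ 0) (hmem : ∀ j, c j ∈ initialVectors F m u)
    (hindep : ∀ j k, j ≠ k → ∀ a : F, a • c j ≠ c k)
    {v : Fin m → F} (hv : v ∈ initialVectors F m u) (hv0 : v ≠ 0) :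
    ∃ j, ∃ a : F, a • c j = v := by
  let f : Fin ν × Fˣ → Fin m → F := fun p => (p.2 : F) • c p.1
  have hf : Function.Injective f := by
    rintro ⟨j, a⟩ ⟨k, b⟩ h
    have h' : (a : F) • c j = (b : F) • c k := h
    have hjk : j = k := by
      by_contra hjk
      apply hindep j k hjk ((b : F)⁻¹ * a)
      rw [mul_smul, h', inv_smul_smul₀ b.ne_zero]
    subst hjk
    rw [Units.ext (smul_left_injective F (hc j) h')]
  have hsub : Finset.univ.image f ⊆ (initialVectors F m u).erase 0 := by
    intro w hw
    obtain ⟨⟨j, a⟩, -, rfl⟩ := Finset.mem_image.mp hw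
    refine Finset.mem_erase.mpr ⟨smul_ne_zero a.ne_zero (hc j), mem_initialVectors.mpr ?_⟩
    intro i hi
    simp [f, mem_initialVectors.mp (hmem j) i hi]
  have h0 : (0 : Fin m → F) ∈ initialVectors F m u := mem_initialVectors.mpr fun _ _ => rfl
  have heq := Finset.eq_of_subset_of_card_le hsub (by
    rw [Finset.card_erase_of_mem h0, card_initialVectors hum, Finset.card_image_of_injective _ hf]
    simp [Fintype.card_units, hν])
  have hvm : v ∈ Finset.univ.image f := heq ▸ Finset.mem_erase.mpr ⟨hv0, hv⟩
  obtain ⟨⟨j, a⟩, -, h⟩ := Finset.mem_image.mp hvm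
  exact ⟨j, a, h⟩

end

/-- `|B(1)| = q^(n_B - m) (q^m - q^u)` and `|B(2)| = q^(n_B - m) (q^u - 1)`
for the supplementary code `B = B_{u,m}`. -/
theorem supplementary_code_subconstituent_sizes
    {F : Type} [Field F] [Fintype F] [DecidableEq F]
    (q m u nu nB : ℕ) (hq : Fintype.card F = q) (hm : 1 < m)
    (hu1 : 1 ≤ u) (hum : u ≤ m - 1)
    (hnu : nu * (q - 1) = q ^ u - 1)
    (hn : (nu + nB) * (q - 1) = q ^ m - 1)
    (H : Matrix (Fin m) (Fin nu ⊕ Fin nB) F)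
    (hcols : ∀ j, (fun i => H i j) ≠ 0)
    (hindep : ∀ j k, j ≠ k → ∀ a : F, (fun i => a * H i j) ≠ (fun i => H i k))
    (hmax : ∀ v : Fin m → F, v ≠ 0 → ∃ j, ∃ a : F, v = fun i => a * H i j)
    (hvan : ∀ j : Fin nu, ∀ i : Fin m, u ≤ (i : ℕ) → H i (Sum.inl j) = 0) :
    Nat.card {x : Fin nB → F |
        distToCode ((suppCode H : Submodule F (Fin nB → F)) : Set (Fin nB → F)) x = 1}
        = q ^ (nB - m) * (q ^ m - q ^ u) ∧
    Nat.card {x : Fin nB → F |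
        distToCode ((suppCode H : Submodule F (Fin nB → F)) : Set (Fin nB → F)) x = 2}
        = q ^ (nB - m) * (q ^ u - 1) := by
  subst hq
  have humm : u ≤ m := by omega
  set W := initialVectors F m u with hW
  have h0W : (0 : Fin m → F) ∈ W := mem_initialVectors.mpr fun _ _ => rfl
  have hinl : ∀ j : Fin nu, (fun i => H i (Sum.inl j)) ∈ W := fun j =>
    mem_initialVectors.mpr (hvan j)
  have hinr : ∀ j : Fin nB, (fun i => H i (Sum.inr j)) ∉ W := by
    intro j hj
    obtain ⟨k, a, h⟩ := exists_eq_smul_of_mem_initialVectors humm hnu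
      (fun j i => H i (Sum.inl j)) (fun j => hcols _) hinl
      (fun j k hjk a => hindep _ _ (fun h => hjk (Sum.inl_injective h)) a) hj (hcols _)
    exact hindep _ _ Sum.inl_ne_inr a h
  set S : (Fin nB → F) →ₗ[F] (Fin m → F) :=
    Matrix.mulVecLin (Matrix.of fun i j => H i (Sum.inr j)) with hSdef
  have hSs : ∀ (j : Fin nB) (a : F), S (Pi.single j a) = fun i => a * H i (Sum.inr j) := by
    intro j a
    ext i
    simp [hSdef, mul_comm]
  have hout : ∀ v, v ∉ W → ∃ e, S e = v ∧ hammingNorm e ≤ 1 := by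
    intro v hv
    obtain ⟨j | j, a, rfl⟩ := hmax v (fun h => hv (h ▸ h0W))
    · refine absurd (mem_initialVectors.mpr fun i hi => ?_) hv
      simp [hvan j i hi]
    · exact ⟨Pi.single j a, hSs j a, hammingNorm_single_le_one j a⟩
  have hin : ∀ v, v ∈ W → ∃ e, S e = v ∧ hammingNorm e ≤ 2 := by
    intro v hv
    let w : Fin m → F := Pi.single ⟨m - 1, by omega⟩ 1
    have hwl : w ⟨m - 1, by omega⟩ = 1 := Pi.single_eq_same _ _
    have hw : w ∉ W := fun h => one_ne_zero (hwl.symm.trans (mem_initialVectors.mp h _ hum))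
    have hvw : v + w ∉ W := by
      intro h
      have h1 := mem_initialVectors.mp h ⟨m - 1, by omega⟩ hum
      rw [Pi.add_apply, hwl, mem_initialVectors.mp hv _ hum, zero_add] at h1
      exact one_ne_zero h1
    obtain ⟨e, he, hed⟩ := hout _ hvw
    obtain ⟨f, hf, hfd⟩ := hout _ hw
    refine ⟨e - f, by simp [he, hf], (hammingNorm_sub_le_add e f).trans (by omega)⟩
  have hsurj : Function.Surjective S := by
    intro v
    by_cases hv : v ∈ W
    · exact (hin v hv).imp fun _ h => h.1
    · exact (hout v hv).imp fun _ h => h.1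
  have hd0 : ∀ x, S x = 0 → distToCode (LinearMap.ker S : Set (Fin nB → F)) x = 0 := fun x hx =>
    distToCode_ker_eq S x 0 ⟨0, by simp [hx], by simp⟩ fun _ _ => Nat.zero_le _
  have hd1 : ∀ x, S x ∉ W → distToCode (LinearMap.ker S : Set (Fin nB → F)) x = 1 := by
    refine fun x hx => distToCode_ker_eq S x 1 (hout _ hx) fun e he => ?_
    refine Nat.one_le_iff_ne_zero.mpr fun h => hx ?_
    rw [← he, hammingNorm_eq_zero.mp h, map_zero]
    exact h0W
  have hd2 : ∀ x, S x ∈ W → S x ≠ 0 →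
      distToCode (LinearMap.ker S : Set (Fin nB → F)) x = 2 := by
    refine fun x hx hx0 => distToCode_ker_eq S x 2 (hin _ hx) fun e he => ?_
    by_contra! hlt
    obtain ⟨j, a, rfl⟩ := exists_eq_single_of_hammingNorm_le_one (Nat.le_of_lt_succ hlt)
      (fun h => hx0 (by rw [← he, h, map_zero]))
    rw [← he, hSs] at hx hx0
    have ha : a ≠ 0 := by
      rintro rfl
      exact hx0 (funext fun i => zero_mul _)
    refine hinr j (mem_initialVectors.mpr fun i hi => ?_)
    exact (mul_eq_zero.mp (mem_initialVectors.mp hx i hi)).resolve_left ha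
  have hs1 : {x | distToCode (LinearMap.ker S : Set (Fin nB → F)) x = 1} = {x | S x ∈ Wᶜ} := by
    ext x
    by_cases hx : S x ∈ W
    · by_cases hx0 : S x = 0
      · simp [hd0 x hx0, hx]
      · simp [hd2 x hx hx0, hx]
    · simp [hd1 x hx, hx]
  have hs2 : {x | distToCode (LinearMap.ker S : Set (Fin nB → F)) x = 2}
      = {x | S x ∈ W.erase 0} := by
    ext x
    by_cases hx : S x ∈ W
    · by_cases hx0 : S x = 0
      · simp [hd0 x hx0, hx0]
      · simp [hd2 x hx hx0, hx, hx0]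
    · simp [hd1 x hx, hx]
  change Nat.card {x | distToCode (LinearMap.ker S : Set (Fin nB → F)) x = 1} = _ ∧
    Nat.card {x | distToCode (LinearMap.ker S : Set (Fin nB → F)) x = 2} = _
  rw [hs1, hs2, card_preimage_of_surjective S hsurj, card_preimage_of_surjective S hsurj,
    Finset.card_compl, Finset.card_erase_of_mem h0W, card_initialVectors humm]
  simp
end

section
/- The supplementary code B_{u,m} is uniformly packed: it is quasi-perfect with e = 1, ρ = 2, and there exist constants λ and μ such that every vector at distance 1 from B_{u,m} has exactly λ codewords at distance 2, and every vector at distance 2 from B_{u,m} has exactly μ codewords at distance 2. -/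
lemma hammingNorm_single_add_single {ι F : Type*} [Fintype ι] [DecidableEq ι] [Field F]
    [DecidableEq F] {j k : ι} (hjk : j ≠ k) {a b : F} (ha : a ≠ 0) (hb : b ≠ 0) :
    hammingNorm (Pi.single j a + Pi.single k b : ι → F) = 2 := by
  rw [hammingNorm, Finset.card_eq_two]
  refine ⟨j, k, hjk, ?_⟩
  ext i
  by_cases h1 : i = j <;> by_cases h2 : i = k <;> simp_all

lemma eq_single_of_hammingNorm_eq_one {ι F : Type*} [Fintype ι] [DecidableEq ι] [Field F]
    [DecidableEq F] {y : ι → F} (hy : hammingNorm y = 1) :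
    ∃ j, y j ≠ 0 ∧ y = Pi.single j (y j) := by
  obtain ⟨j, hj⟩ := Finset.card_eq_one.1 hy
  have hs : ∀ i, y i ≠ 0 ↔ i = j := fun i => by
    have := Finset.ext_iff.1 hj i
    simpa using this
  refine ⟨j, (hs j).2 rfl, ?_⟩
  ext i
  by_cases h : i = j
  · subst h; simp
  · have := not_not.1 ((hs i).not.2 h)
    simp [h, this]

lemma eq_single_add_single_of_hammingNorm_eq_two {ι F : Type*} [Fintype ι] [DecidableEq ι]
    [Field F] [DecidableEq F] {y : ι → F} (hy : hammingNorm y = 2) {j : ι} (hj : y j ≠ 0) :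
    ∃ k, j ≠ k ∧ y k ≠ 0 ∧ y = Pi.single j (y j) + Pi.single k (y k) := by
  have hmem : j ∈ Finset.univ.filter (fun i => y i ≠ 0) := by simpa using hj
  have hc : ((Finset.univ.filter (fun i => y i ≠ 0)).erase j).card = 1 := by
    rw [Finset.card_erase_of_mem hmem]
    simp only [hammingNorm] at hy
    omega
  obtain ⟨k, hk⟩ := Finset.card_eq_one.1 hc
  have hs : ∀ i, (i ≠ j ∧ y i ≠ 0) ↔ i = k := fun i => by
    have := Finset.ext_iff.1 hk i
    simpa using this
  obtain ⟨hkj, hk0⟩ := (hs k).2 rfl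
  refine ⟨k, hkj.symm, hk0, ?_⟩
  ext i
  by_cases h1 : i = j
  · subst h1; simp [hkj.symm]
  · by_cases h2 : i = k
    · subst h2; simp [h1]
    · have := (hs i).not.2 h2
      simp_all

/-- The vectors `h j` represent, up to scalars, exactly once each point outside `U`. -/
structure RepresentsComplement {ι F V : Type*} [Field F] [AddCommGroup V] [Module F V]
    (U : Submodule F V) (h : ι → V) : Prop where
  notMem : ∀ j, h j ∉ U
  exists_smul : ∀ v ∉ U, ∃ j, ∃ a : F, v = a • h j
  smul_ne : ∀ j k, j ≠ k → ∀ a : F, a • h j ≠ h k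

namespace RepresentsComplement

variable {ι F V : Type*} [Field F] [AddCommGroup V] [Module F V]
  {U : Submodule F V} {h : ι → V}

lemma smul_notMem (hh : RepresentsComplement U h) {a : F} (ha : a ≠ 0) (j : ι) :
    a • h j ∉ U :=
  fun H => hh.notMem j ((U.smul_mem_iff ha).1 H)

lemma ne_zero_of_smul_notMem {a : F} {j : ι} (H : a • h j ∉ U) : a ≠ 0 := by
  rintro rfl
  simp at H

lemma eq_of_smul_eq_smul (hh : RepresentsComplement U h) {a b : F} {j k : ι} (hb : b ≠ 0)
    (H : a • h j = b • h k) : j = k := by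
  by_contra hjk
  apply hh.smul_ne j k hjk (b⁻¹ * a)
  rw [mul_smul, H, inv_smul_smul₀ hb]

lemma ne_zero (hh : RepresentsComplement U h) (j : ι) : h j ≠ 0 :=
  fun H => hh.notMem j (H ▸ U.zero_mem)

section Fintype

variable [Fintype ι] [DecidableEq ι] [DecidableEq F]

lemma three_le_hammingNorm (hh : RepresentsComplement U h) {y : ι → F}
    (hy : Fintype.linearCombination F h y = 0) (hy0 : y ≠ 0) : 3 ≤ hammingNorm y := by
  by_contra! hlt
  have h0 : hammingNorm y ≠ 0 := hammingNorm_ne_zero_iff.2 hy0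
  obtain h1 | h2 : hammingNorm y = 1 ∨ hammingNorm y = 2 := by omega
  · obtain ⟨j, hj, e⟩ := eq_single_of_hammingNorm_eq_one h1
    rw [e, Fintype.linearCombination_apply_single] at hy
    exact hh.smul_notMem hj j (hy ▸ U.zero_mem)
  · obtain ⟨j, hj⟩ := Function.ne_iff.1 hy0
    obtain ⟨k, hjk, hk, e⟩ := eq_single_add_single_of_hammingNorm_eq_two h2 hj
    rw [e, map_add, Fintype.linearCombination_apply_single,
      Fintype.linearCombination_apply_single, add_eq_zero_iff_eq_neg, ← neg_smul] at hy
    exact hjk (hh.eq_of_smul_eq_smul (neg_ne_zero.2 hk) hy)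

variable [Fintype F] [Fintype V] [DecidableEq V] [DecidablePred (· ∈ U)]

/-- Each vector of weight two with syndrome `s` is a sum of two weight-one vectors, in two
ways. -/
lemma two_mul_card_weight_two (hh : RepresentsComplement U h) (s : V) :
    2 * (Finset.univ.filter (fun y : ι → F =>
      Fintype.linearCombination F h y = s ∧ hammingNorm y = 2)).card =
    (Finset.univ.filter (fun v : V => v ∉ U ∧ s - v ∉ U ∧ ∀ a : F, s - v ≠ a • v)).card := by
  have hsig : ((Finset.univ.filter (fun y : ι → F =>
      Fintype.linearCombination F h y = s ∧ hammingNorm y = 2)).sigma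
        (fun y => Finset.univ.filter (fun i => y i ≠ 0))).card = 2 *
      (Finset.univ.filter (fun y : ι → F =>
      Fintype.linearCombination F h y = s ∧ hammingNorm y = 2)).card := by
    rw [Finset.card_sigma, Finset.sum_const_nat (m := 2), mul_comm]
    intro y hy
    exact (Finset.mem_filter.1 hy).2.2
  rw [← hsig]
  refine Finset.card_bij (fun p _ => p.1 p.2 • h p.2) ?_ ?_ ?_
  · rintro ⟨y, j⟩ hp
    simp only [Finset.mem_sigma, Finset.mem_filter, Finset.mem_univ, true_and] at hp ⊢
    obtain ⟨⟨hs, h2⟩, hj⟩ := hp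
    obtain ⟨k, hjk, hk, e⟩ := eq_single_add_single_of_hammingNorm_eq_two h2 hj
    rw [e, map_add, Fintype.linearCombination_apply_single,
      Fintype.linearCombination_apply_single] at hs
    have hs' : s - y j • h j = y k • h k := by rw [← hs]; abel
    rw [hs']
    refine ⟨hh.smul_notMem hj j, hh.smul_notMem hk k, fun a ha => hjk ?_⟩
    rw [smul_smul] at ha
    exact hh.eq_of_smul_eq_smul hk ha.symm
  · rintro ⟨y, j⟩ hp ⟨z, l⟩ hp' H
    simp only [Finset.mem_sigma, Finset.mem_filter, Finset.mem_univ, true_and] at hp hp' H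
    obtain ⟨⟨hs, h2⟩, hj⟩ := hp
    obtain ⟨⟨hs', h2'⟩, hl⟩ := hp'
    obtain rfl := hh.eq_of_smul_eq_smul hl H
    have hyz : y j = z j := smul_left_injective F (hh.ne_zero j) H
    obtain ⟨k, hjk, hk, e⟩ := eq_single_add_single_of_hammingNorm_eq_two h2 hj
    obtain ⟨k', hjk', hk', e'⟩ := eq_single_add_single_of_hammingNorm_eq_two h2' hl
    rw [e, map_add, Fintype.linearCombination_apply_single,
      Fintype.linearCombination_apply_single] at hs
    rw [e', map_add, Fintype.linearCombination_apply_single,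
      Fintype.linearCombination_apply_single, ← hs, hyz, add_right_inj] at hs'
    obtain rfl := hh.eq_of_smul_eq_smul hk hs'
    have hyz' : z k' = y k' := smul_left_injective F (hh.ne_zero k') hs'
    have : y = z := by rw [e, e', hyz, hyz']
    rw [this]
  · intro v hv
    simp only [Finset.mem_filter, Finset.mem_univ, true_and] at hv
    obtain ⟨hv, hsv, hprop⟩ := hv
    obtain ⟨j, a, rfl⟩ := hh.exists_smul v hv
    obtain ⟨k, b, hb⟩ := hh.exists_smul _ hsv
    have ha0 := ne_zero_of_smul_notMem hv
    have hb0 : b ≠ 0 := ne_zero_of_smul_notMem (hb ▸ hsv)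
    have hjk : j ≠ k := by
      rintro rfl
      apply hprop (b * a⁻¹)
      rw [hb, smul_smul, inv_mul_cancel_right₀ ha0]
    refine ⟨⟨Pi.single j a + Pi.single k b, j⟩, ?_, ?_⟩
    · simp only [Finset.mem_sigma, Finset.mem_filter, Finset.mem_univ, true_and]
      refine ⟨⟨?_, hammingNorm_single_add_single hjk ha0 hb0⟩, ?_⟩
      · rw [map_add, Fintype.linearCombination_apply_single,
          Fintype.linearCombination_apply_single, ← hb]
        abel
      · simpa [hjk] using ha0
    · simp [hjk]

end Fintype

end RepresentsComplement

section Count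

variable {F V : Type*} [Field F] [Fintype F] [AddCommGroup V] [Module F V]
  [Fintype V] [DecidableEq V] (U : Submodule F V) [DecidablePred (· ∈ U)]

lemma card_nonproportional_of_mem {s : V} (hs : s ∈ U) (hs0 : s ≠ 0) :
    (Finset.univ.filter (fun v : V => v ∉ U ∧ s - v ∉ U ∧ ∀ a : F, s - v ≠ a • v)).card =
      (Finset.univ.filter (fun v : V => v ∉ U)).card := by
  congr 1
  ext v
  simp only [Finset.mem_filter, Finset.mem_univ, true_and, and_iff_left_iff_imp]
  refine fun hv => ⟨fun H => hv ((U.sub_mem_iff_right hs).1 H), fun a ha => ?_⟩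
  have hsv : s = (a + 1) • v := by rw [add_smul, one_smul, ← ha]; abel
  have : a + 1 ≠ 0 := by
    intro h0
    rw [h0, zero_smul] at hsv
    exact hs0 hsv
  exact hv ((U.smul_mem_iff this).1 (hsv ▸ hs))

lemma card_nonproportional_of_notMem {s : V} (hs : s ∉ U) :
    (Finset.univ.filter (fun v : V => v ∉ U ∧ s - v ∉ U ∧ ∀ a : F, s - v ≠ a • v)).card =
      Fintype.card V - (2 * (Finset.univ.filter (fun v : V => v ∈ U)).card +
        (Fintype.card F - 2)) := by
  classical
  have hs0 : s ≠ 0 := fun H => hs (H ▸ U.zero_mem)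
  set A := Finset.univ.filter (fun v : V => v ∈ U)
  set B := A.image (fun v => s - v)
  set C := (Finset.univ \ {0, 1} : Finset F).image (fun a => a • s)
  have hB : B.card = A.card := Finset.card_image_of_injective _ sub_right_injective
  have hC : C.card = Fintype.card F - 2 := by
    rw [Finset.card_image_of_injective _ (smul_left_injective F hs0),
      Finset.card_sdiff_of_subset (Finset.subset_univ _), Finset.card_univ,
      Finset.card_pair zero_ne_one]
  have memA : ∀ v, v ∈ A ↔ v ∈ U := by simp [A]
  have memB : ∀ v, v ∈ B ↔ s - v ∈ U := fun v => by
    simp only [B, Finset.mem_image, memA]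
    constructor
    · rintro ⟨w, hw, rfl⟩; simpa using hw
    · intro H; exact ⟨s - v, H, by simp⟩
  have hAB : Disjoint A B := by
    rw [Finset.disjoint_left]
    intro v h1 h2
    rw [memA] at h1
    rw [memB] at h2
    exact hs ((U.sub_mem_iff_left h1).1 h2)
  have hABC : Disjoint (A ∪ B) C := by
    rw [Finset.disjoint_right]
    intro v h1 h2
    simp only [C, Finset.mem_image, Finset.mem_sdiff, Finset.mem_univ, true_and,
      Finset.mem_insert, Finset.mem_singleton, not_or] at h1
    obtain ⟨a, ⟨ha0, ha1⟩, rfl⟩ := h1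
    rw [Finset.mem_union, memA, memB, U.smul_mem_iff ha0] at h2
    refine h2.elim hs fun h2 => hs ?_
    have : s - a • s = (1 - a) • s := by rw [sub_smul, one_smul]
    rw [this] at h2
    exact (U.smul_mem_iff (sub_ne_zero.2 (Ne.symm ha1))).1 h2
  have hset : Finset.univ.filter
      (fun v : V => v ∉ U ∧ s - v ∉ U ∧ ∀ a : F, s - v ≠ a • v) = (A ∪ B ∪ C)ᶜ := by
    ext v
    rw [Finset.mem_compl, Finset.mem_union, Finset.mem_union, memA, memB]
    simp only [Finset.mem_filter, Finset.mem_univ, true_and, not_or, and_assoc]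
    refine and_congr_right fun hv => and_congr_right fun hsv => not_iff_not.1 ?_
    push Not
    simp only [C, Finset.mem_image, Finset.mem_sdiff, Finset.mem_univ, true_and,
      Finset.mem_insert, Finset.mem_singleton, not_or]
    constructor
    · rintro ⟨a, ha⟩
      have hsv' : s = (a + 1) • v := by rw [add_smul, one_smul, ← ha]; abel
      have h0 : a + 1 ≠ 0 := by
        intro h0
        rw [h0, zero_smul] at hsv'
        exact hs0 hsv'
      refine ⟨(a + 1)⁻¹, ⟨inv_ne_zero h0, fun h1 => hsv ?_⟩, ?_⟩
      · rw [inv_eq_one.1 h1, one_smul] at hsv'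
        simp [hsv']
      · rw [hsv', inv_smul_smul₀ h0]
    · rintro ⟨a, ⟨ha0, ha1⟩, rfl⟩
      refine ⟨a⁻¹ - 1, ?_⟩
      rw [sub_smul, inv_smul_smul₀ ha0, one_smul]
  rw [hset, Finset.card_compl, Finset.card_union_of_disjoint hABC,
    Finset.card_union_of_disjoint hAB, hB, hC, two_mul]

end Count

lemma hammingDist_eq_hammingNorm_sub_s8 {ι F : Type*} [Fintype ι] [Field F] [DecidableEq F]
    (x c : ι → F) :
    hammingDist x c = hammingNorm (x - c) := by
  rw [hammingDist_comm, hammingDist_eq_hammingNorm, neg_add_eq_sub]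

lemma distToCode_le {F : Type} [Fintype F] [DecidableEq F] {n : ℕ} {C : Set (Fin n → F)}
    {x c : Fin n → F} (hc : c ∈ C) :
    distToCode C x ≤ hammingDist x c :=
  Nat.sInf_le ⟨c, hc, rfl⟩

lemma exists_hammingDist_eq_distToCode {F : Type} [Field F] [Fintype F] [DecidableEq F]
    {n : ℕ} (C : Submodule F (Fin n → F)) (x : Fin n → F) :
    ∃ c ∈ C, hammingDist x c = distToCode (C : Set (Fin n → F)) x :=
  Nat.sInf_mem (s := Set.image (hammingDist x) C) ⟨_, 0, C.zero_mem, rfl⟩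

namespace RepresentsComplement

variable {F V : Type} [Field F] [Fintype F] [DecidableEq F] [AddCommGroup V] [Module F V]
  {n : ℕ} {U : Submodule F V} {h : Fin n → V}

lemma distToCode_le_of_syndrome_eq {x y : Fin n → F}
    (hxy : Fintype.linearCombination F h y = Fintype.linearCombination F h x) :
    distToCode (LinearMap.ker (Fintype.linearCombination F h) : Set (Fin n → F)) x ≤
      hammingNorm y := by
  have hc : x - y ∈ LinearMap.ker (Fintype.linearCombination F h) := by
    rw [LinearMap.mem_ker, map_sub, hxy, sub_self]
  refine (distToCode_le hc).trans_eq ?_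
  rw [hammingDist_eq_hammingNorm_sub_s8, sub_sub_cancel]

lemma distToCode_le_one (hh : RepresentsComplement U h) {x : Fin n → F}
    (hx : Fintype.linearCombination F h x ∉ U) :
    distToCode (LinearMap.ker (Fintype.linearCombination F h) : Set (Fin n → F)) x ≤ 1 := by
  obtain ⟨j, a, e⟩ := hh.exists_smul _ hx
  refine (distToCode_le_of_syndrome_eq (y := Pi.single j a) ?_).trans ?_
  · rw [Fintype.linearCombination_apply_single, e]
  · rw [hammingNorm, Finset.card_le_one]
    intro i hi k hk
    by_cases h1 : i = j <;> by_cases h2 : k = j <;> simp_all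

lemma syndrome_notMem (hh : RepresentsComplement U h) {x : Fin n → F}
    (hx : distToCode (LinearMap.ker (Fintype.linearCombination F h) : Set (Fin n → F)) x = 1) :
    Fintype.linearCombination F h x ∉ U := by
  obtain ⟨c, hc, hd⟩ := exists_hammingDist_eq_distToCode
    (LinearMap.ker (Fintype.linearCombination F h)) x
  rw [hx, hammingDist_eq_hammingNorm_sub_s8] at hd
  obtain ⟨j, hj, e⟩ := eq_single_of_hammingNorm_eq_one hd
  have hs : Fintype.linearCombination F h (x - c) = Fintype.linearCombination F h x := by
    rw [map_sub, LinearMap.mem_ker.1 hc, sub_zero]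
  rw [← hs, e, Fintype.linearCombination_apply_single]
  exact hh.smul_notMem hj j

lemma distToCode_le_two (hh : RepresentsComplement U h) [Nonempty (Fin n)] (x : Fin n → F) :
    distToCode (LinearMap.ker (Fintype.linearCombination F h) : Set (Fin n → F)) x ≤ 2 := by
  by_cases hx : Fintype.linearCombination F h x ∈ U
  · obtain ⟨j⟩ := ‹Nonempty (Fin n)›
    obtain ⟨k, b, e⟩ := hh.exists_smul (Fintype.linearCombination F h x - h j)
      fun H => hh.notMem j ((U.sub_mem_iff_right hx).1 H)
    refine (distToCode_le_of_syndrome_eq (y := Pi.single j 1 + Pi.single k b) ?_).trans ?_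
    · rw [map_add, Fintype.linearCombination_apply_single,
        Fintype.linearCombination_apply_single, ← e]
      simp
    · refine (Finset.card_le_card (t := {j, k}) ?_).trans Finset.card_le_two
      intro i
      by_cases h1 : i = j <;> by_cases h2 : i = k <;> simp_all
  · exact (hh.distToCode_le_one hx).trans one_le_two

lemma distToCode_eq_two_iff (hh : RepresentsComplement U h) [Nonempty (Fin n)]
    (x : Fin n → F) :
    distToCode (LinearMap.ker (Fintype.linearCombination F h) : Set (Fin n → F)) x = 2 ↔
      Fintype.linearCombination F h x ∈ U ∧ Fintype.linearCombination F h x ≠ 0 := by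
  constructor
  · intro hx
    constructor
    · by_contra H
      have := hh.distToCode_le_one H
      omega
    · intro H
      have := distToCode_le_of_syndrome_eq (h := h) (x := x) (y := 0) (by rw [H, map_zero])
      simp only [hammingNorm_zero] at this
      omega
  · rintro ⟨hU, h0⟩
    have h2 := hh.distToCode_le_two x
    have h1 : distToCode (LinearMap.ker (Fintype.linearCombination F h) :
        Set (Fin n → F)) x ≠ 1 := fun H => hh.syndrome_notMem H hU
    have h0 : distToCode (LinearMap.ker (Fintype.linearCombination F h) :
        Set (Fin n → F)) x ≠ 0 := by
      intro H
      obtain ⟨c, hc, hd⟩ := exists_hammingDist_eq_distToCode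
        (LinearMap.ker (Fintype.linearCombination F h)) x
      rw [H, hammingDist_eq_zero] at hd
      exact h0 (hd ▸ LinearMap.mem_ker.1 hc)
    omega

lemma exists_distToCode_eq_two (hh : RepresentsComplement U h) [Nonempty (Fin n)]
    (hU : U ≠ ⊥) :
    ∃ x, distToCode (LinearMap.ker (Fintype.linearCombination F h) : Set (Fin n → F)) x = 2 := by
  obtain ⟨s, hs, hs0⟩ := U.ne_bot_iff.1 hU
  obtain ⟨j⟩ := ‹Nonempty (Fin n)›
  obtain ⟨k, b, e⟩ := hh.exists_smul (s - h j)
    fun H => hh.notMem j ((U.sub_mem_iff_right hs).1 H)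
  have : Nonempty (Fin n) := ⟨j⟩
  refine ⟨Pi.single j 1 + Pi.single k b, (hh.distToCode_eq_two_iff _).2 ?_⟩
  rw [map_add, Fintype.linearCombination_apply_single,
    Fintype.linearCombination_apply_single, ← e]
  simpa using ⟨hs, hs0⟩

lemma card_codewords_at_distance_two [Fintype V] [DecidableEq V] (x : Fin n → F) :
    Nat.card {c : Fin n → F | c ∈ LinearMap.ker (Fintype.linearCombination F h) ∧
      hammingDist x c = 2} = (Finset.univ.filter (fun y : Fin n → F =>
        Fintype.linearCombination F h y = Fintype.linearCombination F h x ∧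
          hammingNorm y = 2)).card := by
  rw [← Fintype.card_subtype, ← Nat.card_eq_fintype_card]
  refine Nat.card_congr ((Equiv.subLeft x).subtypeEquiv fun c => ?_)
  simp [hammingDist_eq_hammingNorm_sub_s8]

lemma uniformly_packed (hh : RepresentsComplement U h) [Finite V] [Nonempty (Fin n)] :
    ∃ lam mu : ℕ,
      (∀ x : Fin n → F,
        distToCode (LinearMap.ker (Fintype.linearCombination F h) : Set (Fin n → F)) x = 1 →
        Nat.card {c : Fin n → F | c ∈ LinearMap.ker (Fintype.linearCombination F h) ∧
          hammingDist x c = 2} = lam) ∧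
      (∀ x : Fin n → F,
        distToCode (LinearMap.ker (Fintype.linearCombination F h) : Set (Fin n → F)) x = 2 →
        Nat.card {c : Fin n → F | c ∈ LinearMap.ker (Fintype.linearCombination F h) ∧
          hammingDist x c = 2} = mu) := by
  classical
  have := Fintype.ofFinite V
  refine ⟨(Fintype.card V - (2 * (Finset.univ.filter (fun v : V => v ∈ U)).card +
    (Fintype.card F - 2))) / 2, (Finset.univ.filter (fun v : V => v ∉ U)).card / 2,
    fun x hx => ?_, fun x hx => ?_⟩
  · rw [← card_nonproportional_of_notMem U (hh.syndrome_notMem hx),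
      ← hh.two_mul_card_weight_two, card_codewords_at_distance_two]
    omega
  · obtain ⟨hU, h0⟩ := (hh.distToCode_eq_two_iff x).1 hx
    rw [← card_nonproportional_of_mem U hU h0, ← hh.two_mul_card_weight_two,
      card_codewords_at_distance_two]
    omega

end RepresentsComplement

lemma suppCode_eq_ker {F : Type} [Field F] {m nu nB : ℕ}
    (H : Matrix (Fin m) (Fin nu ⊕ Fin nB) F) :
    suppCode H =
      LinearMap.ker (Fintype.linearCombination F (fun (j : Fin nB) i => H i (Sum.inr j))) := by
  unfold suppCode
  congr 1
  ext y i
  simp [Fintype.linearCombination_apply, Matrix.mulVec, dotProduct, mul_comm]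

/-- The vectors of `F ^ m` that vanish on the last `m - u` coordinates. -/
def vanishingSubmodule (F : Type) [Field F] (m u : ℕ) : Submodule F (Fin m → F) where
  carrier := {v | ∀ i : Fin m, u ≤ (i : ℕ) → v i = 0}
  zero_mem' := by simp
  add_mem' := by
    intro v w hv hw i hi
    simp [hv i hi, hw i hi]
  smul_mem' := by
    intro a v hv i hi
    simp [hv i hi]

lemma exists_eq_mul_of_mem_vanishingSubmodule {F : Type} [Field F] [Fintype F]
    {m u nu : ℕ} (hum : u ≤ m) (hnu : nu * (Fintype.card F - 1) = Fintype.card F ^ u - 1)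
    (g : Fin nu → Fin m → F) (hg : ∀ j, g j ∈ vanishingSubmodule F m u)
    (hg0 : ∀ j, g j ≠ 0) (hindep : ∀ j k, j ≠ k → ∀ a : F, a • g j ≠ g k)
    {v : Fin m → F} (hv : v ∈ vanishingSubmodule F m u) (hv0 : v ≠ 0) :
    ∃ j, ∃ a : F, v = a • g j := by
  classical
  let r : (Fin m → F) → (Fin u → F) := fun v i => v (Fin.castLE hum i)
  have hr : ∀ v ∈ vanishingSubmodule F m u, ∀ w ∈ vanishingSubmodule F m u,
      r v = r w → v = w := by
    intro v hv w hw e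
    ext i
    by_cases hi : u ≤ (i : ℕ)
    · rw [hv i hi, hw i hi]
    · exact congrFun e ⟨i, by omega⟩
  have hr0 : ∀ v ∈ vanishingSubmodule F m u, v ≠ 0 → r v ≠ 0 := fun v hv hv0 e =>
    hv0 (hr v hv 0 (Submodule.zero_mem _) e)
  have hmem : ∀ p : Fin nu × Fˣ, (p.2 : F) • g p.1 ∈ vanishingSubmodule F m u :=
    fun p => Submodule.smul_mem _ _ (hg _)
  let f : Fin nu × Fˣ → {w : Fin u → F // w ≠ 0} := fun p =>
    ⟨r ((p.2 : F) • g p.1), hr0 _ (hmem p) (smul_ne_zero p.2.ne_zero (hg0 _))⟩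
  have hf : Function.Bijective f := by
    rw [Fintype.bijective_iff_injective_and_card]
    constructor
    · rintro ⟨j, a⟩ ⟨k, b⟩ e
      have e' : (a : F) • g j = (b : F) • g k := hr _ (hmem (j, a)) _ (hmem (k, b))
        (congrArg Subtype.val e)
      obtain rfl : j = k := by
        by_contra hjk
        apply hindep j k hjk ((b : F)⁻¹ * a)
        rw [mul_smul, e', inv_smul_smul₀ b.ne_zero]
      rw [Units.ext (smul_left_injective F (hg0 j) e')]
    · rw [Fintype.card_prod, Fintype.card_units, Fintype.card_fin, hnu,
        Fintype.card_subtype_compl, Fintype.card_subtype_eq, Fintype.card_fun, Fintype.card_fin]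
  obtain ⟨⟨j, a⟩, e⟩ := hf.surjective ⟨r v, hr0 v hv hv0⟩
  exact ⟨j, a, (hr _ (hmem (j, a)) _ hv (congrArg Subtype.val e)).symm⟩

/-- `B_{u,m}` is a quasi-perfect (e = 1, ρ = 2) uniformly packed code:
there are constants λ and μ such that every vector at distance 1 from the code has
exactly λ codewords at distance 2 from it, and every vector at distance 2 has
exactly μ codewords at distance 2 from it. -/
theorem supplementary_code_uniformly_packed
    {F : Type} [Field F] [Fintype F] [DecidableEq F]
    (q m u nu nB : ℕ) (hq : Fintype.card F = q) (hm : 1 < m)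
    (hu1 : 1 ≤ u) (hum : u ≤ m - 1)
    (hnu : nu * (q - 1) = q ^ u - 1)
    (hn : (nu + nB) * (q - 1) = q ^ m - 1)
    (H : Matrix (Fin m) (Fin nu ⊕ Fin nB) F)
    (hcols : ∀ j, (fun i => H i j) ≠ 0)
    (hindep : ∀ j k, j ≠ k → ∀ a : F, (fun i => a * H i j) ≠ (fun i => H i k))
    (hmax : ∀ v : Fin m → F, v ≠ 0 → ∃ j, ∃ a : F, v = fun i => a * H i j)
    (hvan : ∀ j : Fin nu, ∀ i : Fin m, u ≤ (i : ℕ) → H i (Sum.inl j) = 0) :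
    -- packing radius e = 1 (minimum distance at least 3)
    (∀ x ∈ suppCode H, x ≠ 0 → 3 ≤ hammingNorm x) ∧
    -- covering radius ρ = 2 = e + 1 (quasi-perfect)
    (∀ x, distToCode ((suppCode H : Submodule F (Fin nB → F)) : Set (Fin nB → F)) x ≤ 2) ∧
    (∃ x, distToCode ((suppCode H : Submodule F (Fin nB → F)) : Set (Fin nB → F)) x = 2) ∧
    -- uniformly packed
    (∃ lam mu : ℕ,
      (∀ x : Fin nB → F,
        distToCode ((suppCode H : Submodule F (Fin nB → F)) : Set (Fin nB → F)) x = 1 →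
        Nat.card {c : Fin nB → F | c ∈ suppCode H ∧ hammingDist x c = 2} = lam) ∧
      (∀ x : Fin nB → F,
        distToCode ((suppCode H : Submodule F (Fin nB → F)) : Set (Fin nB → F)) x = 2 →
        Nat.card {c : Fin nB → F | c ∈ suppCode H ∧ hammingDist x c = 2} = mu)) := by
  subst hq
  have hh : RepresentsComplement (vanishingSubmodule F m u)
      (fun (j : Fin nB) i => H i (Sum.inr j)) := by
    refine ⟨fun j hj => ?_, fun v hv => ?_, fun j k hjk a => ?_⟩
    · obtain ⟨k, a, e⟩ := exists_eq_mul_of_mem_vanishingSubmodule (by omega) hnu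
        (fun j i => H i (Sum.inl j)) (fun j i hi => hvan j i hi) (fun j => hcols _)
        (fun j k hjk a => hindep _ _ (Sum.inl_injective.ne hjk) a) hj (hcols _)
      exact hindep (Sum.inl k) (Sum.inr j) Sum.inl_ne_inr a e.symm
    · obtain ⟨j | j, a, e⟩ := hmax v fun h0 => hv (h0 ▸ Submodule.zero_mem _)
      · refine absurd (fun i hi => ?_) hv
        rw [e]
        simp [hvan j i hi]
      · exact ⟨j, a, e⟩
    · exact hindep _ _ (Sum.inr_injective.ne hjk) a
  have hne : Nonempty (Fin nB) := by
    obtain ⟨j, -⟩ := hh.exists_smul (Pi.single ⟨m - 1, by omega⟩ 1) fun hmem => by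
      have := hmem ⟨m - 1, by omega⟩ hum
      simp at this
    exact ⟨j⟩
  have hU : vanishingSubmodule F m u ≠ ⊥ := by
    refine (Submodule.ne_bot_iff _).2 ⟨Pi.single ⟨0, by omega⟩ 1, fun i hi => ?_, by simp⟩
    apply Pi.single_eq_of_ne
    rintro rfl
    simp only at hi
    omega
  rw [suppCode_eq_ker]
  exact ⟨fun x hx => hh.three_le_hammingNorm hx, hh.distToCode_le_two,
    hh.exists_distToCode_eq_two hU, hh.uniformly_packed⟩
end
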